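/- Let Ω ⊂ ℝⁿ be open and let u ∈ C³(Ω) satisfy Δu = −1 in Ω. Then the function P = ‖∇u‖² + (2/n) u satisfies ΔP = 2 Tr((D²u)²) − 2/n ≥ 0 at every point of Ω, where D²u denotes the Hessian matrix of u; in particular P is subharmonic in Ω. -/

import Mathlib

open MeasureTheory Set
open scoped Topology

noncomputable section

/-- The `i`-th standard basis vector of `EuclideanSpace ℝ (Fin n)`. -/
def stdVec (n : ℕ) (i : Fin n) : EuclideanSpace ℝ (Fin n) := EuclideanSpace.single i 1

/-- The second partial derivative `∂²u/∂xᵢ∂xⱼ`. -/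
noncomputable def secondDeriv (n : ℕ) (u : EuclideanSpace ℝ (Fin n) → ℝ) (i j : Fin n)
    (x : EuclideanSpace ℝ (Fin n)) : ℝ :=
  fderiv ℝ (fun y => fderiv ℝ u y (stdVec n j)) x (stdVec n i)

/-- The Euclidean Laplacian `Δu = ∑ i, ∂²u/∂xᵢ²`. -/
noncomputable def lap (n : ℕ) (u : EuclideanSpace ℝ (Fin n) → ℝ)
    (x : EuclideanSpace ℝ (Fin n)) : ℝ :=
  ∑ i, secondDeriv n u i i x

/-- `Ω` has `C^k` boundary: near every boundary point, `Ω` is the sublevel set of a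
`C^k` local defining function with nonvanishing gradient. -/
def HasCkBoundary {n : ℕ} (k : ℕ∞) (Ω : Set (EuclideanSpace ℝ (Fin n))) : Prop :=
  ∀ x ∈ frontier Ω, ∃ (U : Set (EuclideanSpace ℝ (Fin n))) (f : EuclideanSpace ℝ (Fin n) → ℝ),
    IsOpen U ∧ x ∈ U ∧ ContDiffOn ℝ k f U ∧ (∀ y ∈ U, gradient f y ≠ 0) ∧
    Ω ∩ U = {y ∈ U | f y < 0} ∧ frontier Ω ∩ U = {y ∈ U | f y = 0}

/-- `ν` is the outward unit normal vector field on the boundary of `Ω`. -/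
def IsOutwardUnitNormal {n : ℕ} (Ω : Set (EuclideanSpace ℝ (Fin n)))
    (ν : EuclideanSpace ℝ (Fin n) → EuclideanSpace ℝ (Fin n)) : Prop :=
  ∀ x ∈ frontier Ω, ‖ν x‖ = 1 ∧ ∃ ε > 0, ∀ t : ℝ, 0 < t → t < ε →
    x + t • ν x ∉ closure Ω ∧ x - t • ν x ∈ Ω

section

variable {n : ℕ} {f : EuclideanSpace ℝ (Fin n) → ℝ} {Ω : Set (EuclideanSpace ℝ (Fin n))}
  {x : EuclideanSpace ℝ (Fin n)}

theorem norm_gradient_sq_eq_sum (f : EuclideanSpace ℝ (Fin n) → ℝ)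
    (x : EuclideanSpace ℝ (Fin n)) :
    ‖gradient f x‖ ^ 2 = ∑ k, fderiv ℝ f x (stdVec n k) ^ 2 := by
  rw [EuclideanSpace.norm_sq_eq]
  refine Finset.sum_congr rfl fun k _ => ?_
  have h : fderiv ℝ f x (stdVec n k) = gradient f x k := by
    rw [← InnerProductSpace.toDual_symm_apply (𝕜 := ℝ) (y := fderiv ℝ f x), stdVec,
      EuclideanSpace.inner_single_right]
    simp [gradient]
  rw [h, Real.norm_eq_abs, sq_abs]

theorem contDiffAt_fderiv_stdVec {k m : WithTop ℕ∞} (hf : ContDiffAt ℝ k f x) (hm : m + 1 ≤ k)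
    (i : Fin n) : ContDiffAt ℝ m (fun y => fderiv ℝ f y (stdVec n i)) x :=
  (hf.fderiv_right hm).clm_apply contDiffAt_const

theorem secondDeriv_comm (hf : ContDiffAt ℝ 2 f x) (i j : Fin n) :
    secondDeriv n f i j x = secondDeriv n f j i x := by
  have hd : DifferentiableAt ℝ (fderiv ℝ f) x :=
    (hf.fderiv_right (m := 1) (by norm_num)).differentiableAt (by norm_num)
  have h (a b : Fin n) :
      secondDeriv n f a b x = fderiv ℝ (fderiv ℝ f) x (stdVec n a) (stdVec n b) := by
    simp [secondDeriv, fderiv_clm_apply hd (differentiableAt_const _)]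
  rw [h, h]
  exact (hf.isSymmSndFDerivAt (by simp)).eq _ _

theorem ContDiffAt.differentiableAt_secondDeriv (hf : ContDiffAt ℝ 3 f x) (i j : Fin n) :
    DifferentiableAt ℝ (secondDeriv n f i j) x :=
  (contDiffAt_fderiv_stdVec (m := 1)
    (contDiffAt_fderiv_stdVec (m := 2) hf (by norm_num) j) (by norm_num) i).differentiableAt
    (by norm_num)

/-- The Laplacian commutes with partial derivatives. -/
theorem lap_fderiv_stdVec (hΩ : IsOpen Ω) (hf : ContDiffOn ℝ 3 f Ω) (hx : x ∈ Ω) (k : Fin n) :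
    lap n (fun y => fderiv ℝ f y (stdVec n k)) x = fderiv ℝ (lap n f) x (stdVec n k) := by
  have hfx (y) (hy : y ∈ Ω) : ContDiffAt ℝ 3 f y := hf.contDiffAt (hΩ.mem_nhds hy)
  have hlap : fderiv ℝ (lap n f) x = ∑ i, fderiv ℝ (secondDeriv n f i i) x :=
    fderiv_fun_sum fun i _ => (hfx x hx).differentiableAt_secondDeriv i i
  rw [hlap, sum_apply]
  refine Finset.sum_congr rfl fun i _ => ?_
  have hcomm : secondDeriv n f i k =ᶠ[𝓝 x] secondDeriv n f k i := by
    filter_upwards [hΩ.mem_nhds hx] with y hy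
    exact secondDeriv_comm ((hfx y hy).of_le (by norm_num)) i k
  calc secondDeriv n (fun y => fderiv ℝ f y (stdVec n k)) i i x
      = fderiv ℝ (secondDeriv n f i k) x (stdVec n i) :=
        rfl
    _ = fderiv ℝ (secondDeriv n f k i) x (stdVec n i) := by rw [hcomm.fderiv_eq]
    _ = secondDeriv n (fun y => fderiv ℝ f y (stdVec n i)) i k x := rfl
    _ = secondDeriv n (fun y => fderiv ℝ f y (stdVec n i)) k i x :=
        secondDeriv_comm (contDiffAt_fderiv_stdVec (hfx x hx) (by norm_num) i) i k
    _ = fderiv ℝ (secondDeriv n f i i) x (stdVec n k) := rfl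

/-- A Bochner-type formula in Euclidean space. -/
theorem lap_norm_gradient_sq_add_const_mul (hΩ : IsOpen Ω) (hf : ContDiffOn ℝ 3 f Ω)
    (hx : x ∈ Ω) (c : ℝ) :
    lap n (fun y => ‖gradient f y‖ ^ 2 + c * f y) x
      = 2 * ∑ i, ∑ j, secondDeriv n f i j x * secondDeriv n f j i x
        + 2 * ∑ k, fderiv ℝ f x (stdVec n k) * fderiv ℝ (lap n f) x (stdVec n k)
        + c * lap n f x := by
  have hfx (y) (hy : y ∈ Ω) : ContDiffAt ℝ 3 f y := hf.contDiffAt (hΩ.mem_nhds hy)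
  have hg (y) (hy : y ∈ Ω) (k : Fin n) :
      DifferentiableAt ℝ (fun z => fderiv ℝ f z (stdVec n k)) y :=
    (contDiffAt_fderiv_stdVec (m := 2) (hfx y hy) (by norm_num) k).differentiableAt (by norm_num)
  have hfst (i : Fin n) (y) (hy : y ∈ Ω) :
      fderiv ℝ (fun y => ‖gradient f y‖ ^ 2 + c * f y) y (stdVec n i)
        = ∑ k, 2 * (fderiv ℝ f y (stdVec n k) * secondDeriv n f i k y)
          + c * fderiv ℝ f y (stdVec n i) := by
    simp only [norm_gradient_sq_eq_sum]
    have h := (HasFDerivAt.fun_sum fun k (_ : k ∈ Finset.univ) =>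
      (hg y hy k).hasFDerivAt.pow 2).fun_add
      (((hfx y hy).differentiableAt (by norm_num)).hasFDerivAt.const_mul c)
    rw [h.fderiv]
    simp [secondDeriv, mul_assoc]
  have hsnd (i : Fin n) : secondDeriv n (fun y => ‖gradient f y‖ ^ 2 + c * f y) i i x
      = ∑ k, 2 * (fderiv ℝ f x (stdVec n k)
            * secondDeriv n (fun y => fderiv ℝ f y (stdVec n k)) i i x
          + secondDeriv n f i k x * secondDeriv n f i k x)
        + c * secondDeriv n f i i x := by
    have heq : (fun y => fderiv ℝ (fun y => ‖gradient f y‖ ^ 2 + c * f y) y (stdVec n i))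
        =ᶠ[𝓝 x] fun y => ∑ k, 2 * (fderiv ℝ f y (stdVec n k) * secondDeriv n f i k y)
          + c * fderiv ℝ f y (stdVec n i) := by
      filter_upwards [hΩ.mem_nhds hx] with y hy using hfst i y hy
    have h := (HasFDerivAt.fun_sum fun k (_ : k ∈ Finset.univ) =>
      (((hg x hx k).hasFDerivAt.fun_mul
        ((hfx x hx).differentiableAt_secondDeriv i k).hasFDerivAt).const_mul 2)).fun_add
      ((hg x hx i).hasFDerivAt.const_mul c)
    rw [secondDeriv, heq.fderiv_eq, h.fderiv]
    simp only [add_apply, sum_apply,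
      smul_apply, smul_eq_mul]
    rfl
  have hthird (k : Fin n) := lap_fderiv_stdVec hΩ hf hx k
  have hsymm (i j : Fin n) : secondDeriv n f j i x = secondDeriv n f i j x :=
    secondDeriv_comm ((hfx x hx).of_le (by norm_num)) j i
  simp only [← hthird]
  simp only [lap, hsnd, Finset.sum_add_distrib, mul_add, Finset.mul_sum]
  rw [Finset.sum_comm, add_comm (∑ k, ∑ i, _)]
  congr 2
  refine Finset.sum_congr rfl fun i _ => Finset.sum_congr rfl fun j _ => ?_
  rw [hsymm i j]

theorem lap_sq_le_mul_sum_secondDeriv_mul (hf : ContDiffAt ℝ 2 f x) :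
    lap n f x ^ 2 ≤ n * ∑ i, ∑ j, secondDeriv n f i j x * secondDeriv n f j i x := by
  calc lap n f x ^ 2 ≤ n * ∑ i, secondDeriv n f i i x ^ 2 := by
        simpa [lap] using sq_sum_le_card_mul_sum_sq (s := Finset.univ)
          (f := fun i => secondDeriv n f i i x)
    _ ≤ n * ∑ i, ∑ j, secondDeriv n f i j x * secondDeriv n f j i x := by
        gcongr with i
        have h := Finset.single_le_sum (f := fun j => secondDeriv n f i j x * secondDeriv n f j i x)
          (fun j _ => by
            rw [secondDeriv_comm hf j i]
            exact mul_self_nonneg _) (Finset.mem_univ i)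
        simpa only [sq] using h

end

/-- **Weinberger's P-function is subharmonic.** If `u ∈ C³(Ω)` satisfies `Δu = -1` in the open
set `Ω ⊆ ℝⁿ`, then `P = ‖∇u‖² + (2/n) u` satisfies
`ΔP = 2 Tr((D²u)²) - 2/n ≥ 0` at every point of `Ω`. -/
theorem weinberger_P_function_subharmonic (n : ℕ)
    (Ω : Set (EuclideanSpace ℝ (Fin n))) (hΩo : IsOpen Ω)
    (u : EuclideanSpace ℝ (Fin n) → ℝ) (hu : ContDiffOn ℝ 3 u Ω)
    (hpde : ∀ x ∈ Ω, lap n u x = -1) :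
    ∀ x ∈ Ω,
      lap n (fun y => ‖gradient u y‖ ^ 2 + 2 / n * u y) x
        = 2 * (∑ i, ∑ j, secondDeriv n u i j x * secondDeriv n u j i x) - 2 / n
      ∧ 0 ≤ lap n (fun y => ‖gradient u y‖ ^ 2 + 2 / n * u y) x := by
  intro x hx
  have hu2 : ContDiffAt ℝ 2 u x := (hu.contDiffAt (hΩo.mem_nhds hx)).of_le (by norm_num)
  have hconst : fderiv ℝ (lap n u) x = 0 := by
    have h : lap n u =ᶠ[𝓝 x] fun _ => -1 := by
      filter_upwards [hΩo.mem_nhds hx] with y hy using hpde y hy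
    rw [h.fderiv_eq, fderiv_fun_const]
    rfl
  have hlap : lap n (fun y => ‖gradient u y‖ ^ 2 + 2 / n * u y) x
      = 2 * (∑ i, ∑ j, secondDeriv n u i j x * secondDeriv n u j i x) - 2 / n := by
    rw [lap_norm_gradient_sq_add_const_mul hΩo hu hx, hconst, hpde x hx]
    simp [sub_eq_add_neg]
  refine ⟨hlap, ?_⟩
  have hn : 0 < (n : ℝ) := by
    rcases Nat.eq_zero_or_pos n with rfl | h
    · have := hpde x hx
      simp [lap] at this
    · exact_mod_cast h
  have hcs := lap_sq_le_mul_sum_secondDeriv_mul hu2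
  rw [hpde x hx] at hcs
  rw [hlap, sub_nonneg, div_le_iff₀ hn]
  linarith
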